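/- arXiv:1407.2348 — 2 statements merged into one kernel-verified Lean document; each statement's English description precedes it below -/
import Mathlib

section
/- Let m be even and let f(x) = ∑_{i=1}^n f_{m,i} x_i^m + ∑_{α ∈ Ω_f} f_α x^α be a homogeneous polynomial of degree m on ℝ^n with essentially nonpositive coefficients, i.e., f_α ≤ 0 for every exponent multi-index α that is not of the form m·e_i. If f(x) ≥ 0 for all x ∈ ℝ^n, then f is a sum of squares of polynomials. -/
open Finset MvPolynomial

noncomputable section

/-- Entrywise inner product of two m-th order n-dimensional tensors. -/
def tIP {m n : ℕ} (A B : (Fin m → Fin n) → ℝ) : ℝ :=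
  ∑ i : Fin m → Fin n, A i * B i

/-- The rank-one tensor `x^{⊗m}` with entries `x_{i_1} ⋯ x_{i_m}`. -/
def rk1 {n : ℕ} (m : ℕ) (x : Fin n → ℝ) : (Fin m → Fin n) → ℝ :=
  fun i => ∏ k, x (i k)

/-- A tensor is symmetric if invariant under permutations of its indices. -/
def TSymm {m n : ℕ} (A : (Fin m → Fin n) → ℝ) : Prop :=
  ∀ (σ : Equiv.Perm (Fin m)) (i : Fin m → Fin n), A (i ∘ σ) = A i

/-- Essentially nonpositive: entries with indices not all equal are ≤ 0. -/
def EssNonpos {m n : ℕ} (A : (Fin m → Fin n) → ℝ) : Prop :=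
  ∀ i : Fin m → Fin n, (¬ ∀ k l, i k = i l) → A i ≤ 0

/-- `U_{m,n}`: convex hull of the rank-one tensors `x^{⊗m}`. -/
def Ucone (m n : ℕ) : Set ((Fin m → Fin n) → ℝ) :=
  convexHull ℝ {X | ∃ x : Fin n → ℝ, X = rk1 m x}

/-- The tensor `P^m A`. -/
def pmul {m n : ℕ} (P : Matrix (Fin n) (Fin n) ℝ) (A : (Fin m → Fin n) → ℝ) :
    (Fin m → Fin n) → ℝ :=
  fun i => ∑ j : Fin m → Fin n, (∏ k, P (i k) (j k)) * A j

/-- A real-valued function on ℝⁿ is a sum of squares of polynomials. -/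
def IsSOSFun {n : ℕ} (f : (Fin n → ℝ) → ℝ) : Prop :=
  ∃ (r : ℕ) (g : Fin r → MvPolynomial (Fin n) ℝ),
    ∀ x, f x = ∑ j, (MvPolynomial.eval x (g j)) ^ 2

/-- A polynomial is a sum of squares of polynomials. -/
def IsSOSPoly {n : ℕ} (f : MvPolynomial (Fin n) ℝ) : Prop :=
  ∃ (r : ℕ) (g : Fin r → MvPolynomial (Fin n) ℝ), f = ∑ j, (g j) ^ 2

/-- A polynomial has essentially nonpositive coefficients (w.r.t. degree m):
    every coefficient except the constant term and those of `x_i^m` is ≤ 0. -/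
def EssNonposCoeff {n : ℕ} (m : ℕ) (f : MvPolynomial (Fin n) ℝ) : Prop :=
  ∀ α : Fin n →₀ ℕ, α ≠ 0 → (∀ i, α ≠ Finsupp.single i m) → f.coeff α ≤ 0

theorem IsSumSq.pow {R : Type*} [CommSemiring R] {a : R} (ha : IsSumSq a) (k : ℕ) :
    IsSumSq (a ^ k) := by
  have h : IsSumSq (∏ _i ∈ Finset.range k, a) := IsSumSq.prod fun _ _ => ha
  rwa [Finset.prod_const, Finset.card_range] at h

theorem IsSumSq.algebraMap_mul {R : Type*} [CommRing R] [Algebra ℝ R] {c : ℝ} (hc : 0 ≤ c)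
    {a : R} (ha : IsSumSq a) : IsSumSq (algebraMap ℝ R c * a) := by
  have h : IsSumSq (algebraMap ℝ R c) := by
    rw [← Real.mul_self_sqrt hc, map_mul]
    exact IsSumSq.mul_self _
  exact h.mul ha

theorem IsSumSq.of_natCast_mul {R : Type*} [CommRing R] [Algebra ℝ R] {k : ℕ} (hk : k ≠ 0)
    {a : R} (ha : IsSumSq ((k : R) * a)) : IsSumSq a := by
  have h := ha.algebraMap_mul (c := (k : ℝ)⁻¹) (by positivity)
  rwa [← map_natCast (algebraMap ℝ R) k, ← mul_assoc, ← map_mul,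
    inv_mul_cancel₀ (Nat.cast_ne_zero.2 hk), map_one, one_mul] at h

theorem isSumSq_sub_mul_pow_sub_pow {R : Type*} [CommRing R] {a b : R}
    (ha : IsSumSq a) (hb : IsSumSq b) (k : ℕ) : IsSumSq ((a - b) * (a ^ k - b ^ k)) := by
  rw [← (Commute.all a b).mul_geom_sum₂, ← mul_assoc]
  exact (IsSumSq.mul_self _).mul
    (IsSumSq.sum fun i _ => (ha.pow _).mul (hb.pow _))

/-- Hurwitz's proof of the inequality of arithmetic and geometric means. -/
theorem isSumSq_sum_pow_card_sub_card_mul_prod {R ι : Type*} [CommRing R] [Algebra ℝ R]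
    [DecidableEq ι] (a : ι → R) (ha : ∀ i, IsSumSq (a i)) (k : ℕ) :
    ∀ s : Finset ι, s.card = k → IsSumSq (∑ i ∈ s, a i ^ k - k * ∏ i ∈ s, a i) := by
  induction k with
  | zero => intro s hs; simp [Finset.card_eq_zero.1 hs]
  | succ k ih =>
    intro s hs
    rcases Nat.eq_zero_or_pos k with rfl | hk
    · obtain ⟨i, rfl⟩ := Finset.card_eq_one.1 hs
      simp
    apply IsSumSq.of_natCast_mul (k := 2 * k) (by omega)
    have h₁ : IsSumSq (∑ i ∈ s, a i *
        (∑ j ∈ s.erase i, a j ^ k - k * ∏ j ∈ s.erase i, a j)) :=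
      IsSumSq.sum fun i hi => (ha i).mul
        (ih _ (by rw [Finset.card_erase_of_mem hi, hs, Nat.add_sub_cancel]))
    have h₂ : IsSumSq (∑ i ∈ s, ∑ j ∈ s, (a i - a j) * (a i ^ k - a j ^ k)) :=
      IsSumSq.sum fun i _ => IsSumSq.sum fun j _ =>
        isSumSq_sub_mul_pow_sub_pow (ha i) (ha j) k
    have e₁ : ∑ i ∈ s, a i * (∑ j ∈ s.erase i, a j ^ k - k * ∏ j ∈ s.erase i, a j) =
        (∑ i ∈ s, a i) * (∑ i ∈ s, a i ^ k) - ∑ i ∈ s, a i ^ (k + 1)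
          - (k + 1) * (k * ∏ i ∈ s, a i) := by
      have : ∀ i ∈ s, a i * (∑ j ∈ s.erase i, a j ^ k - k * ∏ j ∈ s.erase i, a j) =
          a i * (∑ i ∈ s, a i ^ k) - a i ^ (k + 1) - k * ∏ i ∈ s, a i := by
        intro i hi
        rw [← Finset.mul_prod_erase s a hi, ← Finset.add_sum_erase s _ hi]
        ring
      rw [Finset.sum_congr rfl this]
      simp only [Finset.sum_sub_distrib, ← Finset.sum_mul, Finset.sum_const, hs, nsmul_eq_mul]
      push_cast
      ring
    have e₂ : ∑ i ∈ s, ∑ j ∈ s, (a i - a j) * (a i ^ k - a j ^ k) =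
        2 * ((k + 1) * ∑ i ∈ s, a i ^ (k + 1) - (∑ i ∈ s, a i) * (∑ i ∈ s, a i ^ k)) := by
      have : ∀ i j, (a i - a j) * (a i ^ k - a j ^ k) =
          a i ^ (k + 1) - a i * a j ^ k - a j * a i ^ k + a j ^ (k + 1) := fun i j => by ring
      simp only [this, Finset.sum_add_distrib, Finset.sum_sub_distrib, ← Finset.mul_sum,
        ← Finset.sum_mul, Finset.sum_const, hs, nsmul_eq_mul]
      push_cast
      ring
    rw [e₁] at h₁
    rw [e₂] at h₂
    refine (congrArg IsSumSq ?_).mp ((h₁.add h₁).add h₂)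
    push_cast
    ring

theorem isSumSq_sum_pow_sub_prod_of_card_eq {R ι : Type*} [CommRing R] [Algebra ℝ R]
    [DecidableEq ι] (y : ι → R) (k : ℕ) (s : Finset ι) (hs : s.card = 2 * k) :
    IsSumSq (∑ i ∈ s, y i ^ (2 * k) - (2 * k : ℕ) * ∏ i ∈ s, y i) := by
  obtain ⟨t, hts, ht⟩ := Finset.exists_subset_card_eq (n := k) (s := s) (by omega)
  have hd : (s \ t).card = k := by rw [Finset.card_sdiff_of_subset hts]; omega
  have hy : ∀ i, IsSumSq (y i ^ 2) := fun i => by rw [sq]; exact IsSumSq.mul_self _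
  have h₁ := isSumSq_sum_pow_card_sub_card_mul_prod (fun i => y i ^ 2) hy k t ht
  have h₂ := isSumSq_sum_pow_card_sub_card_mul_prod (fun i => y i ^ 2) hy k _ hd
  have h₃ : IsSumSq ((k : R) * ((∏ i ∈ s \ t, y i - ∏ i ∈ t, y i) *
      (∏ i ∈ s \ t, y i - ∏ i ∈ t, y i))) := by
    exact (IsSumSq.natCast k).mul (IsSumSq.mul_self _)
  refine (congrArg IsSumSq ?_).mp ((h₁.add h₂).add h₃)
  rw [← Finset.sum_sdiff hts, ← Finset.prod_sdiff hts]
  simp only [← pow_mul, Finset.prod_pow]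
  push_cast
  ring

theorem isSumSq_sum_mul_pow_sub_prod_pow {R ι : Type*} [CommRing R] [Algebra ℝ R]
    [Fintype ι] [DecidableEq ι] (y : ι → R) (α : ι → ℕ) {m : ℕ} (hm : Even m)
    (hα : ∑ i, α i = m) :
    IsSumSq (∑ i, α i * y i ^ m - m * ∏ i, y i ^ α i) := by
  obtain ⟨k, rfl⟩ := even_iff_two_dvd.1 hm
  have h := isSumSq_sum_pow_sub_prod_of_card_eq (fun p : (i : ι) × Fin (α i) => y p.1) k
    Finset.univ (by simp [hα])
  simpa [Fintype.sum_sigma, Fintype.prod_sigma] using h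

theorem IsSumSq.isSOSPoly {n : ℕ} {f : MvPolynomial (Fin n) ℝ} (hf : IsSumSq f) :
    IsSOSPoly f := by
  induction hf with
  | zero => exact ⟨0, Fin.elim0, by simp⟩
  | sq_add a _ ih =>
    obtain ⟨r, g, rfl⟩ := ih
    exact ⟨r + 1, Fin.cons a g, by simp [Fin.sum_univ_succ, sq]⟩

theorem sum_coeff_mul_prod_mul_eq_zero {n : ℕ} {g : MvPolynomial (Fin n) ℝ}
    (hnonneg : ∀ x : Fin n → ℝ, (∀ i, 0 ≤ x i) → 0 ≤ eval x g)
    {u : Fin n → ℝ} (hu : ∀ i, 0 < u i) (hgu : eval u g = 0) (i : Fin n) :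
    ∑ α ∈ g.support, g.coeff α * (∏ j, u j ^ α j) * α i = 0 := by
  have key : ∀ s : ℝ, eval (Function.update u i (s * u i)) g =
      ∑ α ∈ g.support, g.coeff α * (∏ j, u j ^ α j) * s ^ α i := by
    intro s
    rw [eval_eq']
    refine Finset.sum_congr rfl fun α _ => ?_
    rw [mul_assoc, ← Finset.mul_prod_erase _ _ (Finset.mem_univ i),
      ← Finset.mul_prod_erase _ (fun j => u j ^ α j) (Finset.mem_univ i), Function.update_self,
      mul_pow]
    rw [Finset.prod_congr rfl fun j hj => by rw [Function.update_of_ne (Finset.ne_of_mem_erase hj)]]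
    ring
  have hder : HasDerivAt (fun s : ℝ => ∑ α ∈ g.support, g.coeff α * (∏ j, u j ^ α j) * s ^ α i)
      (∑ α ∈ g.support, g.coeff α * (∏ j, u j ^ α j) * α i) 1 := by
    refine HasDerivAt.fun_sum fun α _ => ?_
    simpa using (hasDerivAt_pow (α i) (1 : ℝ)).const_mul (g.coeff α * ∏ j, u j ^ α j)
  refine IsLocalMin.hasDerivAt_eq_zero ?_ hder
  filter_upwards [lt_mem_nhds (show (0 : ℝ) < 1 by norm_num)] with s hs
  rw [← key, ← key, one_mul, Function.update_eq_self, hgu]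
  refine hnonneg _ fun j => ?_
  rcases eq_or_ne j i with rfl | hj
  · simpa using (mul_pos hs (hu j)).le
  · simpa [hj] using (hu j).le

theorem isSumSq_of_eval_eq_zero_of_pos {n m : ℕ} (hm : Even m) (hm0 : m ≠ 0)
    {g : MvPolynomial (Fin n) ℝ} (hhom : g.IsHomogeneous m)
    (hcoeff : ∀ α : Fin n →₀ ℕ, (∀ i, α ≠ Finsupp.single i m) → g.coeff α ≤ 0)
    (hnonneg : ∀ x : Fin n → ℝ, (∀ i, 0 ≤ x i) → 0 ≤ eval x g)
    {u : Fin n → ℝ} (hu : ∀ i, 0 < u i) (hgu : eval u g = 0) : IsSumSq g := by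
  apply IsSumSq.of_natCast_mul hm0
  set y : Fin n → MvPolynomial (Fin n) ℝ := fun i => C (u i)⁻¹ * X i with hy
  have hsum : IsSumSq (∑ α ∈ g.support, algebraMap ℝ (MvPolynomial (Fin n) ℝ)
      (-(g.coeff α * ∏ j, u j ^ α j)) * (∑ i, α i * y i ^ m - m * ∏ i, y i ^ α i)) := by
    refine IsSumSq.sum fun α hα => ?_
    have hdeg : ∑ i, α i = m := by
      rw [← Finsupp.degree_eq_sum]
      exact hhom.degree_eq_sum_deg_support hα |>.symm
    by_cases h : ∃ i, α = Finsupp.single i m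
    · obtain ⟨i, rfl⟩ := h
      have : (∑ j, ((Finsupp.single i m j : ℕ) : MvPolynomial (Fin n) ℝ) * y j ^ m -
          m * ∏ j, y j ^ (Finsupp.single i m j)) = 0 := by
        rw [Finset.sum_eq_single i, Finset.prod_eq_single i] <;>
          simp +contextual [eq_comm]
      rw [this, mul_zero]
      exact IsSumSq.zero
    · push Not at h
      refine IsSumSq.algebraMap_mul ?_ (isSumSq_sum_mul_pow_sub_prod_pow y α hm hdeg)
      rw [neg_nonneg]
      exact mul_nonpos_of_nonpos_of_nonneg (hcoeff α h)
        (Finset.prod_nonneg fun j _ => pow_nonneg (hu j).le _)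
  refine (congrArg IsSumSq ?_).mp hsum
  symm
  have h₁ : ∑ α ∈ g.support, algebraMap ℝ (MvPolynomial (Fin n) ℝ)
      (g.coeff α * ∏ j, u j ^ α j) * ∑ i, α i * y i ^ m = 0 := by
    simp only [Finset.mul_sum]
    rw [Finset.sum_comm]
    refine Finset.sum_eq_zero fun i _ => ?_
    have := congrArg (algebraMap ℝ (MvPolynomial (Fin n) ℝ))
      (sum_coeff_mul_prod_mul_eq_zero hnonneg hu hgu i)
    simp only [map_sum, map_zero, map_mul, map_natCast] at this
    simp only [← mul_assoc, ← Finset.sum_mul, map_mul]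
    rw [this, zero_mul]
  have h₂ : ∀ α : Fin n →₀ ℕ, algebraMap ℝ (MvPolynomial (Fin n) ℝ)
      (g.coeff α * ∏ j, u j ^ α j) * ∏ i, y i ^ α i = monomial α (g.coeff α) := by
    intro α
    rw [monomial_eq, Finsupp.prod_fintype _ _ (by simp), algebraMap_eq, C_mul, mul_assoc,
      map_prod, ← Finset.prod_mul_distrib]
    congr 1
    refine Finset.prod_congr rfl fun j _ => ?_
    rw [C_pow, ← mul_pow, hy, ← mul_assoc, ← C_mul, mul_inv_cancel₀ (hu j).ne', C_1, one_mul]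
  calc (m : MvPolynomial (Fin n) ℝ) * g
      = m * (∑ α ∈ g.support, monomial α (g.coeff α)) := by rw [← as_sum]
    _ = m * (∑ α ∈ g.support, algebraMap ℝ (MvPolynomial (Fin n) ℝ)
          (g.coeff α * ∏ j, u j ^ α j) * ∏ i, y i ^ α i) -
        ∑ α ∈ g.support, algebraMap ℝ (MvPolynomial (Fin n) ℝ)
          (g.coeff α * ∏ j, u j ^ α j) * ∑ i, α i * y i ^ m := by
        rw [h₁, sub_zero, Finset.sum_congr rfl fun α _ => h₂ α]
    _ = _ := by
        rw [Finset.mul_sum, ← Finset.sum_sub_distrib]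
        refine Finset.sum_congr rfl fun α _ => ?_
        rw [map_neg]
        ring

/-- The sum of those terms of `f` whose exponent has support contained in `Q`. -/
def restrictVars {n : ℕ} (Q : Finset (Fin n)) (f : MvPolynomial (Fin n) ℝ) :
    MvPolynomial (Fin n) ℝ :=
  ∑ α ∈ f.support with α.support ⊆ Q, monomial α (f.coeff α)

theorem coeff_restrictVars {n : ℕ} (Q : Finset (Fin n)) (f : MvPolynomial (Fin n) ℝ)
    (β : Fin n →₀ ℕ) :
    (restrictVars Q f).coeff β = if β.support ⊆ Q then f.coeff β else 0 := by
  simp only [restrictVars, coeff_sum, coeff_monomial, Finset.sum_ite_eq', Finset.mem_filter,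
    mem_support_iff]
  by_cases h : f.coeff β = 0 <;> simp [h]

theorem eval_congr_of_support {n : ℕ} {f : MvPolynomial (Fin n) ℝ} {x y : Fin n → ℝ}
    (h : ∀ α ∈ f.support, ∀ i ∈ α.support, x i = y i) : eval x f = eval y f := by
  rw [eval_eq, eval_eq]
  refine Finset.sum_congr rfl fun α hα => ?_
  rw [Finset.prod_congr rfl fun i hi => by rw [h α hα i hi]]

theorem eval_restrictVars {n : ℕ} (Q : Finset (Fin n)) (f : MvPolynomial (Fin n) ℝ)
    (x : Fin n → ℝ) :
    eval x (restrictVars Q f) = eval (fun i => if i ∈ Q then x i else 0) f := by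
  rw [restrictVars, map_sum, Finset.sum_filter, eval_eq]
  refine Finset.sum_congr rfl fun α _ => ?_
  split_ifs with h
  · rw [eval_monomial, Finsupp.prod]
    congr 1
    exact Finset.prod_congr rfl fun i hi => by rw [if_pos (h hi)]
  · obtain ⟨i, hi, hiQ⟩ := Finset.not_subset.1 h
    rw [Finset.prod_eq_zero hi, mul_zero]
    rw [if_neg hiQ, zero_pow (Finsupp.mem_support_iff.1 hi)]

theorem MvPolynomial.IsHomogeneous.eval_smul {n m : ℕ} {f : MvPolynomial (Fin n) ℝ}
    (hf : f.IsHomogeneous m) (r : ℝ) (x : Fin n → ℝ) :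
    eval (fun i => r * x i) f = r ^ m * eval x f := by
  rw [eval_eq, eval_eq, Finset.mul_sum]
  refine Finset.sum_congr rfl fun α hα => ?_
  rw [hf.degree_eq_sum_deg_support hα, ← Finset.prod_pow_eq_pow_sum]
  simp only [mul_pow, Finset.prod_mul_distrib]
  ring

/-- At a nonnegative zero of a nonnegative form with essentially nonpositive coefficients, no term
involves both vanishing and nonvanishing coordinates. -/
theorem support_subset_or_disjoint_of_eval_eq_zero {n m : ℕ}
    {g : MvPolynomial (Fin n) ℝ} (hhom : g.IsHomogeneous m)
    (hcoeff : ∀ α : Fin n →₀ ℕ, (∀ i, α ≠ Finsupp.single i m) → g.coeff α ≤ 0)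
    (hnonneg : ∀ x : Fin n → ℝ, (∀ i, 0 ≤ x i) → 0 ≤ eval x g)
    {u : Fin n → ℝ} {S : Finset (Fin n)} (huS : ∀ i ∈ S, 0 < u i) (huS' : ∀ i ∉ S, u i = 0)
    (hgu : eval u g = 0) {α : Fin n →₀ ℕ} (hα : α ∈ g.support) :
    α.support ⊆ S ∨ Disjoint α.support S := by
  by_contra! hcross
  have hne : ∀ β : Fin n →₀ ℕ, ¬ β.support ⊆ S → ¬ Disjoint β.support S →
      g.coeff β ≤ 0 := by
    intro β h₁ h₂
    refine hcoeff β ?_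
    rintro i rfl
    have hs := Finsupp.support_single_subset (a := i) (b := m)
    by_cases hi : i ∈ S
    · exact h₁ (hs.trans (by simpa using hi))
    · exact h₂ (Finset.disjoint_of_subset_left hs (by simpa using hi))
  set w : ℝ := ∏ i ∈ α.support, (if i ∈ S then u i else 1) ^ α i with hw
  have hw0 : 0 < w := Finset.prod_pos fun i _ => by
    split_ifs with h
    · exact pow_pos (huS i h) _
    · simp
  set K : ℝ := ∑ β ∈ g.support, |g.coeff β| with hK
  have hK0 : 0 ≤ K := Finset.sum_nonneg fun _ _ => abs_nonneg _
  have hgα : g.coeff α < 0 :=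
    lt_of_le_of_ne (hne α hcross.1 hcross.2) (mem_support_iff.1 hα)
  have hu0 : ∀ β : Fin n →₀ ℕ, ¬ β.support ⊆ S → ∏ i ∈ β.support, u i ^ β i = 0 := by
    intro β hβ
    obtain ⟨i, hi, hiS⟩ := Finset.not_subset.1 hβ
    exact Finset.prod_eq_zero hi (by rw [huS' i hiS, zero_pow (Finsupp.mem_support_iff.1 hi)])
  have hbound : ∀ t : ℝ, 0 < t → t ≤ 1 → 0 ≤ K * t + g.coeff α * w := by
    intro t ht ht1
    set x : Fin n → ℝ := fun i => if i ∈ S then u i else t with hx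
    have hx0 : ∀ i, 0 < x i := fun i => by
      by_cases h : i ∈ S <;> simp [hx, h, ht, huS]
    have hm : 0 < m := by
      rw [hhom.degree_eq_sum_deg_support hα]
      obtain ⟨i, hi, -⟩ := Finset.not_subset.1 hcross.1
      exact Finset.sum_pos (fun i hi => Nat.pos_of_ne_zero (Finsupp.mem_support_iff.1 hi)) ⟨i, hi⟩
    have hαx : ∏ i ∈ α.support, x i ^ α i ≥ w * t ^ (m - 1) := by
      have hsplit : ∏ i ∈ α.support, x i ^ α i =
          w * t ^ (∑ i ∈ α.support with i ∉ S, α i) := by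
        rw [hw, ← Finset.prod_pow_eq_pow_sum, Finset.prod_filter, ← Finset.prod_mul_distrib]
        refine Finset.prod_congr rfl fun i _ => ?_
        by_cases h : i ∈ S <;> simp [hx, h]
      rw [hsplit]
      refine mul_le_mul_of_nonneg_left (pow_le_pow_of_le_one ht.le ht1 ?_) hw0.le
      obtain ⟨i, hi, hiS⟩ := Finset.not_disjoint_iff.1 hcross.2
      have hlt : ∑ i ∈ α.support with i ∉ S, α i < ∑ i ∈ α.support, α i :=
        Finset.sum_lt_sum_of_subset (Finset.filter_subset _ _) hi (by simp [hiS])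
          (Nat.pos_of_ne_zero (Finsupp.mem_support_iff.1 hi)) (fun _ _ _ => Nat.zero_le _)
      rw [← hhom.degree_eq_sum_deg_support hα] at hlt
      omega
    have hterm : ∀ β ∈ g.support, g.coeff β * ∏ i ∈ β.support, x i ^ β i ≤
        g.coeff β * ∏ i ∈ β.support, u i ^ β i + |g.coeff β| * t ^ m +
          if β = α then g.coeff α * w * t ^ (m - 1) else 0 := by
      intro β hβ
      have habs : 0 ≤ |g.coeff β| * t ^ m := by positivity
      by_cases hβα : β = α
      · subst hβα
        rw [if_pos rfl, hu0 _ hcross.1]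
        nlinarith [mul_le_mul_of_nonpos_left hαx hgα.le]
      rw [if_neg hβα]
      by_cases h₁ : β.support ⊆ S
      · have : ∏ i ∈ β.support, x i ^ β i = ∏ i ∈ β.support, u i ^ β i :=
          Finset.prod_congr rfl fun i hi => by simp [hx, h₁ hi]
        rw [this]
        linarith
      rw [hu0 _ h₁]
      by_cases h₂ : Disjoint β.support S
      · have : ∏ i ∈ β.support, x i ^ β i = t ^ m := by
          rw [hhom.degree_eq_sum_deg_support hβ, ← Finset.prod_pow_eq_pow_sum]
          exact Finset.prod_congr rfl fun i hi => by
            simp [hx, Finset.disjoint_left.1 h₂ hi]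
        rw [this]
        nlinarith [le_abs_self (g.coeff β), pow_pos ht m]
      · have := mul_nonpos_of_nonpos_of_nonneg (hne β h₁ h₂)
          (Finset.prod_nonneg fun i (_ : i ∈ β.support) => pow_nonneg (hx0 i).le (β i))
        linarith
    have hle : 0 ≤ K * t ^ m + g.coeff α * w * t ^ (m - 1) := by
      have h := (hnonneg x fun i => (hx0 i).le).trans
        ((eval_eq x g).trans_le (Finset.sum_le_sum hterm))
      rwa [Finset.sum_add_distrib, Finset.sum_add_distrib, ← eval_eq, hgu, zero_add,
        ← Finset.sum_mul, Finset.sum_ite_eq', if_pos hα] at h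
    have hpow : t ^ m = t * t ^ (m - 1) := by
      rw [← pow_succ', Nat.sub_add_cancel hm]
    rw [hpow, ← mul_assoc, ← add_mul] at hle
    exact nonneg_of_mul_nonneg_left hle (pow_pos ht _)
  have hc : 0 < -(g.coeff α * w) := neg_pos.2 (mul_neg_of_neg_of_pos hgα hw0)
  set c := -(g.coeff α * w)
  have hden : 0 < c + K + 1 := by positivity
  have h := hbound (c / (c + K + 1)) (by positivity) (by rw [div_le_one hden]; linarith)
  have : K * (c / (c + K + 1)) < c := by
    rw [mul_div_assoc', div_lt_iff₀ hden]
    nlinarith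
  linarith [neg_neg (g.coeff α * w)]

theorem exists_isMinOn_sum_pow_eq_one {n m : ℕ} (hm0 : m ≠ 0) (f : MvPolynomial (Fin n) ℝ)
    {T : Finset (Fin n)} (hT : T.Nonempty) :
    ∃ u : Fin n → ℝ, (∀ i, 0 ≤ u i) ∧ (∀ i ∉ T, u i = 0) ∧ ∑ i ∈ T, u i ^ m = 1 ∧
      ∀ x : Fin n → ℝ, (∀ i, 0 ≤ x i) → (∀ i ∉ T, x i = 0) → ∑ i ∈ T, x i ^ m = 1 →
        eval u f ≤ eval x f := by
  set K : Set (Fin n → ℝ) :=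
    {x | (∀ i, 0 ≤ x i) ∧ (∀ i ∉ T, x i = 0) ∧ ∑ i ∈ T, x i ^ m = 1} with hK
  have hclosed : IsClosed K := by
    simp only [hK, Set.ofPred_and, Set.ofPred_forall]
    refine (isClosed_iInter fun i => isClosed_le continuous_const (continuous_apply i)).inter
      (IsClosed.inter (isClosed_iInter fun i => isClosed_iInter fun _ =>
        isClosed_eq (continuous_apply i) continuous_const) (isClosed_eq ?_ continuous_const))
    fun_prop
  have hsub : K ⊆ Set.Icc 0 1 := by
    rintro x ⟨hx0, hxT, hx1⟩
    refine ⟨hx0, fun i => ?_⟩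
    by_cases hi : i ∈ T
    · have : x i ^ m ≤ 1 := hx1 ▸
        Finset.single_le_sum (f := fun i => x i ^ m) (fun j _ => pow_nonneg (hx0 j) m) hi
      exact (pow_le_one_iff_of_nonneg (hx0 i) hm0).1 this
    · simp [hxT i hi]
  have hcomp : IsCompact K := isCompact_Icc.of_isClosed_subset hclosed hsub
  have hne : K.Nonempty := by
    obtain ⟨j, hj⟩ := hT
    refine ⟨Pi.single j 1, fun i => ?_, fun i hi => ?_, ?_⟩
    · by_cases h : i = j <;> simp [h]
    · exact Pi.single_eq_of_ne (ne_of_mem_of_not_mem hj hi).symm _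
    · rw [Finset.sum_eq_single_of_mem j hj] <;> simp +contextual [hm0]
  obtain ⟨u, hu, hmin⟩ := hcomp.exists_isMinOn hne (MvPolynomial.continuous_eval f).continuousOn
  exact ⟨u, hu.1, hu.2.1, hu.2.2, fun x h₀ h₁ h₂ => hmin ⟨h₀, h₁, h₂⟩⟩

theorem mul_sum_pow_le_eval {n m : ℕ} (hm0 : m ≠ 0) {f : MvPolynomial (Fin n) ℝ}
    (hhom : f.IsHomogeneous m) {T : Finset (Fin n)}
    (hT : ∀ α ∈ f.support, α.support ⊆ T) {μ : ℝ}
    (hμ : ∀ x : Fin n → ℝ, (∀ i, 0 ≤ x i) → (∀ i ∉ T, x i = 0) → ∑ i ∈ T, x i ^ m = 1 →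
        μ ≤ eval x f)
    (hnonneg : ∀ x : Fin n → ℝ, (∀ i, 0 ≤ x i) → 0 ≤ eval x f)
    {x : Fin n → ℝ} (hx : ∀ i, 0 ≤ x i) : μ * ∑ i ∈ T, x i ^ m ≤ eval x f := by
  have hs0 : 0 ≤ ∑ i ∈ T, x i ^ m := Finset.sum_nonneg fun i _ => pow_nonneg (hx i) m
  rcases hs0.eq_or_lt with hs | hs
  · rw [← hs, mul_zero]
    exact hnonneg x hx
  set s := ∑ i ∈ T, x i ^ m with hs_def
  set r : ℝ := (s⁻¹) ^ ((m : ℝ)⁻¹) with hr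
  have hr0 : 0 ≤ r := by positivity
  have hrm : r ^ m = s⁻¹ := Real.rpow_inv_natCast_pow (inv_nonneg.2 hs0) hm0
  set z : Fin n → ℝ := fun i => if i ∈ T then x i else 0 with hz
  have hz0 : ∀ i, 0 ≤ z i := fun i => by by_cases h : i ∈ T <;> simp [hz, h, hx]
  have h := hμ (fun i => r * z i) (fun i => mul_nonneg hr0 (hz0 i))
    (fun i hi => by simp [hz, hi]) (by
      have : ∀ i ∈ T, (r * z i) ^ m = s⁻¹ * x i ^ m := fun i hi => by
        rw [mul_pow, hrm]
        simp [hz, hi]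
      rw [Finset.sum_congr rfl this, ← Finset.mul_sum, ← hs_def, inv_mul_cancel₀ hs.ne'])
  have hzx : eval z f = eval x f := eval_congr_of_support fun α hα i hi => by
    simp [hz, hT α hα hi]
  rw [hhom.eval_smul, hrm, hzx, inv_mul_eq_div, le_div_iff₀ hs] at h
  exact h

theorem isSumSq_of_nonneg_of_support_subset {n m : ℕ} (hm : Even m) (hm0 : m ≠ 0)
    (T : Finset (Fin n)) : ∀ f : MvPolynomial (Fin n) ℝ, f.IsHomogeneous m →
    (∀ α : Fin n →₀ ℕ, (∀ i, α ≠ Finsupp.single i m) → f.coeff α ≤ 0) →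
    (∀ x : Fin n → ℝ, (∀ i, 0 ≤ x i) → 0 ≤ eval x f) →
    (∀ α ∈ f.support, α.support ⊆ T) → IsSumSq f := by
  induction T using Finset.strongInduction with
  | H T ih =>
  intro f hhom hcoeff hnonneg hT
  rcases T.eq_empty_or_nonempty with rfl | hTne
  · have : f = 0 := by
      rw [← support_eq_empty, Finset.eq_empty_iff_forall_notMem]
      intro α hα
      apply hm0
      rw [hhom.degree_eq_sum_deg_support hα, Finset.subset_empty.1 (hT α hα), Finset.sum_empty]
    exact this ▸ IsSumSq.zero
  obtain ⟨u, hu0, huT, hu1, hmin⟩ := exists_isMinOn_sum_pow_eq_one hm0 f hTne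
  set μ := eval u f with hμ
  have hμ0 : 0 ≤ μ := hnonneg u hu0
  set p : MvPolynomial (Fin n) ℝ := ∑ i ∈ T, monomial (Finsupp.single i m) μ with hp
  have hpeval : ∀ x, eval x p = μ * ∑ i ∈ T, x i ^ m := fun x => by
    simp [hp, eval_monomial, Finset.mul_sum]
  have hpcoeff : ∀ α : Fin n →₀ ℕ, (∀ i ∈ T, α ≠ Finsupp.single i m) → p.coeff α = 0 := by
    intro α hα
    rw [hp, coeff_sum]
    exact Finset.sum_eq_zero fun i hi => by rw [coeff_monomial, if_neg (hα i hi).symm]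
  have hpsq : IsSumSq p := by
    refine IsSumSq.sum fun i _ => ?_
    have h : monomial (Finsupp.single i m) μ =
        algebraMap ℝ (MvPolynomial (Fin n) ℝ) μ * X i ^ m := by
      rw [algebraMap_eq, C_mul_X_pow_eq_monomial]
    rw [h]
    exact (hm.isSquare_pow _).isSumSq.algebraMap_mul hμ0
  set g := f - p with hg
  have hghom : g.IsHomogeneous m := hhom.sub
    (IsHomogeneous.sum _ _ _ fun i _ => isHomogeneous_monomial _ (Finsupp.degree_single i m))
  have hgcoeff : ∀ α : Fin n →₀ ℕ, (∀ i, α ≠ Finsupp.single i m) → g.coeff α ≤ 0 := by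
    intro α hα
    rw [hg, coeff_sub, hpcoeff α fun i _ => hα i, sub_zero]
    exact hcoeff α hα
  have hgnonneg : ∀ x : Fin n → ℝ, (∀ i, 0 ≤ x i) → 0 ≤ eval x g := by
    intro x hx
    rw [hg, map_sub, hpeval, sub_nonneg]
    exact mul_sum_pow_le_eval hm0 hhom hT hmin hnonneg hx
  have hgT : ∀ α ∈ g.support, α.support ⊆ T := by
    intro α hα
    by_contra h
    refine mem_support_iff.1 hα ?_
    rw [hg, coeff_sub, notMem_support_iff.1 (mt (hT α) h), hpcoeff α, sub_zero]
    rintro i hi rfl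
    exact h (Finsupp.support_single_subset.trans (by simpa using hi))
  have hgu : eval u g = 0 := by rw [hg, map_sub, hpeval, hu1, mul_one, sub_self]
  set S : Finset (Fin n) := {i | 0 < u i} with hS
  have huS : ∀ i ∈ S, 0 < u i := fun i hi => by simpa [hS] using hi
  have huS' : ∀ i ∉ S, u i = 0 := fun i hi =>
    le_antisymm (by simpa [hS] using hi) (hu0 i)
  have hST : S ⊆ T := fun i hi => by
    by_contra h
    exact (huS i hi).ne' (huT i h)
  have hSne : S.Nonempty := by
    rw [Finset.nonempty_iff_ne_empty]
    intro h
    have : ∀ i ∈ T, u i ^ m = 0 := fun i _ => by rw [huS' i (by simp [h]), zero_pow hm0]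
    rw [Finset.sum_eq_zero this] at hu1
    exact zero_ne_one hu1
  have hdich := fun α (hα : α ∈ g.support) =>
    support_subset_or_disjoint_of_eval_eq_zero hghom hgcoeff hgnonneg huS huS' hgu hα
  have hsplit : g = restrictVars S g + restrictVars (T \ S) g := by
    ext α
    rw [coeff_add, coeff_restrictVars, coeff_restrictVars]
    by_cases hα : α ∈ g.support
    · have hα0 : α.support.Nonempty := by
        rw [Finset.nonempty_iff_ne_empty]
        intro h
        apply hm0
        rw [hghom.degree_eq_sum_deg_support hα, h, Finset.sum_empty]
      rcases hdich α hα with h | h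
      · have : ¬ α.support ⊆ T \ S := fun h' => by
          obtain ⟨i, hi⟩ := hα0
          exact (Finset.mem_sdiff.1 (h' hi)).2 (h hi)
        rw [if_pos h, if_neg this, add_zero]
      · have h₁ : ¬ α.support ⊆ S := fun h' => by
          obtain ⟨i, hi⟩ := hα0
          exact Finset.disjoint_left.1 h hi (h' hi)
        rw [if_neg h₁, if_pos (Finset.subset_sdiff.2 ⟨hgT α hα, h⟩), zero_add]
    · rw [notMem_support_iff.1 hα]
      simp
  have hrhom : ∀ Q, (restrictVars Q g).IsHomogeneous m := fun Q =>
    IsHomogeneous.sum _ _ _ fun α hα => isHomogeneous_monomial _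
      (hghom.degree_eq_sum_deg_support (Finset.mem_filter.1 hα).1).symm
  have hrcoeff : ∀ Q, ∀ α : Fin n →₀ ℕ, (∀ i, α ≠ Finsupp.single i m) →
      (restrictVars Q g).coeff α ≤ 0 := by
    intro Q α hα
    rw [coeff_restrictVars]
    split_ifs
    exacts [hgcoeff α hα, le_rfl]
  have hrnonneg : ∀ Q, ∀ x : Fin n → ℝ, (∀ i, 0 ≤ x i) → 0 ≤ eval x (restrictVars Q g) := by
    intro Q x hx
    rw [eval_restrictVars]
    exact hgnonneg _ fun i => by split_ifs; exacts [hx i, le_rfl]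
  have h₁ : IsSumSq (restrictVars S g) := by
    refine isSumSq_of_eval_eq_zero_of_pos hm hm0 (hrhom S) (hrcoeff S) (hrnonneg S)
      (u := fun i => if i ∈ S then u i else 1) (fun i => ?_) ?_
    · split_ifs with h
      exacts [huS i h, one_pos]
    · have hu : (fun i => if i ∈ S then (if i ∈ S then u i else 1) else 0) = u := by
        funext i
        by_cases h : i ∈ S <;> simp [h, huS']
      rw [eval_restrictVars, hu, hgu]
  have h₂ : IsSumSq (restrictVars (T \ S) g) := by
    refine ih _ (Finset.sdiff_ssubset hST hSne) _ (hrhom _) (hrcoeff _) (hrnonneg _) ?_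
    intro α hα
    rw [mem_support_iff, coeff_restrictVars] at hα
    by_contra h
    exact hα (if_neg h)
  have hfg : f = restrictVars S g + restrictVars (T \ S) g + p := by
    rw [← hsplit, hg, sub_add_cancel]
  rw [hfg]
  exact (h₁.add h₂).add hpsq

/-- A nonnegative homogeneous polynomial of even degree `m` with essentially
nonpositive coefficients is a sum of squares. -/
theorem stmt6 (n m : ℕ) (hm : Even m) (f : MvPolynomial (Fin n) ℝ)
    (hhom : f.IsHomogeneous m)
    (hcoeff : ∀ α : Fin n →₀ ℕ, (∀ i, α ≠ Finsupp.single i m) → f.coeff α ≤ 0)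
    (hnonneg : ∀ x : Fin n → ℝ, 0 ≤ MvPolynomial.eval x f) :
    IsSOSPoly f := by
  apply IsSumSq.isSOSPoly
  rcases eq_or_ne m 0 with rfl | hm0
  · have hf : f = C (f.coeff 0) :=
      totalDegree_eq_zero_iff_eq_C.1 (Nat.le_zero.1 hhom.totalDegree_le)
    have h0 : 0 ≤ f.coeff 0 := by
      have h := hnonneg 0
      rwa [hf, eval_C] at h
    rw [hf, ← mul_one (C _), ← algebraMap_eq]
    exact IsSumSq.one.algebraMap_mul h0
  · exact isSumSq_of_nonneg_of_support_subset hm hm0 Finset.univ f hhom hcoeff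
      (fun x _ => hnonneg x) fun _ _ => Finset.subset_univ _
end
end

section
/- (Tensor analogy of Yuan's theorem of the alternative) Let m be even and F_0,...,F_p symmetric m-th order n-dimensional tensors. Suppose there exists a nonsingular n×n matrix P such that each P^m F_l is essentially nonpositive. Then exactly one of the following holds: (i) there exists x ∈ ℝ^n with ⟨F_l, x^{⊗m}⟩ < 0 for all l = 0,...,p; (ii) there exist λ_l ≥ 0 with ∑_{l=0}^p λ_l = 1 such that the homogeneous polynomial x ↦ ⟨∑_l λ_l F_l, x^{⊗m}⟩ is a sum of squares. -/
open Finset MvPolynomial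

noncomputable section

section SumOfSquares

variable {R : Type*} [CommRing R]

theorem IsSumSq.natPow {x : R} (hx : IsSumSq x) (k : ℕ) : IsSumSq (x ^ k) := by
  induction k with
  | zero => simp
  | succ k ih => rw [pow_succ]; exact ih.mul hx

theorem IsSumSq.sub_mul_pow_sub_pow {a b : R} (ha : IsSumSq a) (hb : IsSumSq b) (k : ℕ) :
    IsSumSq ((a - b) * (a ^ k - b ^ k)) := by
  rw [← Commute.mul_geom_sum₂ (Commute.all a b), ← mul_assoc]
  exact (IsSumSq.mul_self _).mul
    (IsSumSq.sum fun i _ => (ha.natPow i).mul (hb.natPow _))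

theorem isSumSq_pow_of_even {m : ℕ} (hm : Even m) (x : R) : IsSumSq (x ^ m) := by
  obtain ⟨d, rfl⟩ := hm
  rw [pow_add]
  exact IsSumSq.mul_self _

variable [Algebra ℝ R]

theorem IsSumSq.smul_nonneg {a : ℝ} (ha : 0 ≤ a) {x : R} (hx : IsSumSq x) :
    IsSumSq (a • x) := by
  have h : a • x = algebraMap ℝ R (√a) * algebraMap ℝ R (√a) * x := by
    rw [← map_mul, Real.mul_self_sqrt ha, Algebra.smul_def]
  rw [h]
  exact (IsSumSq.mul_self _).mul hx

/-- The arithmetic-geometric mean form evaluated at sums of squares is a sum of squares. -/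
theorem IsSumSq.sum_pow_sub_card_mul_prod {ι : Type*} [DecidableEq ι] (u : ι → R)
    (hu : ∀ i, IsSumSq (u i)) (s : Finset ι) :
    IsSumSq (∑ i ∈ s, u i ^ s.card - (s.card : ℝ) • ∏ i ∈ s, u i) := by
  induction hd : s.card generalizing s with
  | zero => simp [Finset.card_eq_zero.mp hd]
  | succ d ih =>
    rcases Nat.eq_zero_or_pos d with rfl | hd0
    · obtain ⟨a, rfl⟩ := Finset.card_eq_one.mp hd
      simp
    have key : ∑ i ∈ s, u i ^ (d + 1) - ((d + 1 : ℕ) : ℝ) • ∏ i ∈ s, u i =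
        (1 / (d : ℝ)) • ((1 / 2 : ℝ) • (∑ i ∈ s, ∑ j ∈ s, (u i - u j) * (u i ^ d - u j ^ d)) +
          ∑ i ∈ s, u i * (∑ j ∈ s.erase i, u j ^ d - (d : ℝ) • ∏ j ∈ s.erase i, u j)) := by
      have h1 : ∑ i ∈ s, u i * (∑ j ∈ s.erase i, u j ^ d - (d : ℝ) • ∏ j ∈ s.erase i, u j) =
          (∑ i ∈ s, u i) * (∑ i ∈ s, u i ^ d) - ∑ i ∈ s, u i ^ (d + 1) -
            ((d + 1 : ℕ) : ℝ) • (d : ℝ) • ∏ i ∈ s, u i := by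
        have : ∀ i ∈ s, u i * (∑ j ∈ s.erase i, u j ^ d - (d : ℝ) • ∏ j ∈ s.erase i, u j) =
            u i * (∑ i ∈ s, u i ^ d) - u i ^ (d + 1) - (d : ℝ) • ∏ i ∈ s, u i := by
          intro i hi
          rw [← Finset.mul_prod_erase s u hi, ← Finset.add_sum_erase s (fun i => u i ^ d) hi,
            mul_sub, mul_smul_comm]
          ring
        rw [Finset.sum_congr rfl this, Finset.sum_sub_distrib, Finset.sum_sub_distrib,
          Finset.sum_mul, Finset.sum_const, hd]
        simp only [Nat.cast_smul_eq_nsmul]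
      have h2 : ∑ i ∈ s, ∑ j ∈ s, (u i - u j) * (u i ^ d - u j ^ d) =
          (2 : ℝ) • (((d + 1 : ℕ) : ℝ) • ∑ i ∈ s, u i ^ (d + 1) -
            (∑ i ∈ s, u i) * (∑ i ∈ s, u i ^ d)) := by
        have : ∀ i ∈ s, ∀ j ∈ s, (u i - u j) * (u i ^ d - u j ^ d) =
            (u i ^ (d + 1) + u j ^ (d + 1)) - (u i * u j ^ d + u j * u i ^ d) := by
          intro i _ j _
          ring
        rw [Finset.sum_congr rfl fun i hi => Finset.sum_congr rfl (this i hi)]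
        simp only [Finset.sum_sub_distrib, Finset.sum_add_distrib, ← Finset.mul_sum,
          ← Finset.sum_mul, Finset.sum_const, hd]
        rw [Nat.cast_smul_eq_nsmul, ofNat_smul_eq_nsmul, ← Finset.smul_sum]
        simp only [nsmul_eq_mul]
        push_cast
        ring
      rw [h1, h2]
      have hd' : (d : ℝ) ≠ 0 := by positivity
      match_scalars <;> field_simp <;> ring
    rw [key]
    refine IsSumSq.smul_nonneg (by positivity) (IsSumSq.add (IsSumSq.smul_nonneg (by norm_num)
      (IsSumSq.sum fun i _ => IsSumSq.sum fun j _ => (hu i).sub_mul_pow_sub_pow (hu j) d))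
      (IsSumSq.sum fun i hi => (hu i).mul (ih _ ?_)))
    rw [Finset.card_erase_of_mem hi, hd, Nat.add_sub_cancel]

/-- Hurwitz: the arithmetic-geometric mean form of even degree is a sum of squares. -/
theorem isSumSq_sum_pow_sub_mul_prod {m : ℕ} (hm : Even m) (y : Fin m → R) :
    IsSumSq (∑ j, y j ^ m - (m : ℝ) • ∏ j, y j) := by
  obtain ⟨d, rfl⟩ := hm
  have h (f : Fin d → R) : IsSumSq (∑ j, f j ^ (d + d) - (d : ℝ) • ∏ j, f j * f j) := by
    have := IsSumSq.sum_pow_sub_card_mul_prod (fun j => f j * f j)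
      (fun j => IsSumSq.mul_self _) Finset.univ
    simpa [mul_pow, ← pow_add] using this
  have key : ∑ j, y j ^ (d + d) - ((d + d : ℕ) : ℝ) • ∏ j, y j =
      ((∑ j, y (Fin.castAdd d j) ^ (d + d) -
        (d : ℝ) • ∏ j, y (Fin.castAdd d j) * y (Fin.castAdd d j)) +
      (∑ j, y (Fin.natAdd d j) ^ (d + d) -
        (d : ℝ) • ∏ j, y (Fin.natAdd d j) * y (Fin.natAdd d j))) +
      (d : ℝ) • ((∏ j, y (Fin.castAdd d j) - ∏ j, y (Fin.natAdd d j)) *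
        (∏ j, y (Fin.castAdd d j) - ∏ j, y (Fin.natAdd d j))) := by
    rw [Fin.sum_univ_add, Fin.prod_univ_add, Finset.prod_mul_distrib, Finset.prod_mul_distrib]
    simp only [Algebra.smul_def]
    push_cast [map_natCast]
    ring
  rw [key]
  exact ((h _).add (h _)).add (IsSumSq.smul_nonneg (by positivity) (IsSumSq.mul_self _))

/-- A form `∑ wⱼ yⱼᵐ - c ∏ yⱼ` of even degree `m` in `m` variables which is nonnegative on the
nonnegative orthant is a sum of squares. -/
theorem isSumSq_sum_smul_pow_sub_smul_prod {m : ℕ} (hm : Even m) (hm0 : 0 < m)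
    {w : Fin m → ℝ} (hw : ∀ j, 0 ≤ w j) {c : ℝ} (hc : 0 ≤ c)
    (h : ∀ x : Fin m → ℝ, (∀ j, 0 ≤ x j) → c * ∏ j, x j ≤ ∑ j, w j * x j ^ m)
    (y : Fin m → R) :
    IsSumSq (∑ j, w j • y j ^ m - c • ∏ j, y j) := by
  have hsum : IsSumSq (∑ j, w j • y j ^ m) :=
    IsSumSq.sum fun j _ => IsSumSq.smul_nonneg (hw j) (isSumSq_pow_of_even hm _)
  have hmR : (m : ℝ) ≠ 0 := by positivity
  by_cases hpos : ∀ j, 0 < w j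
  · set s : Fin m → ℝ := fun j => (m * w j) ^ ((m : ℝ)⁻¹) with hs
    have hs0 : ∀ j, 0 < s j := fun j => Real.rpow_pos_of_pos (mul_pos (by positivity) (hpos j)) _
    have hsm : ∀ j, s j ^ m = m * w j := fun j =>
      Real.rpow_inv_natCast_pow (mul_nonneg (by positivity) (hw j)) hm0.ne'
    set q := ∏ j, s j with hq
    have hq0 : 0 < q := Finset.prod_pos fun j _ => hs0 j
    have hcq : c ≤ q := by
      have h1 := h (fun j => (s j)⁻¹) fun j => (inv_pos.mpr (hs0 j)).le
      have h2 : ∀ j, w j * (s j)⁻¹ ^ m = (m : ℝ)⁻¹ := by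
        intro j
        rw [inv_pow, hsm]
        have := (hpos j).ne'
        field_simp
      rw [Finset.sum_congr rfl fun j _ => h2 j, Finset.prod_inv_distrib, ← hq] at h1
      simp only [Finset.sum_const, Finset.card_univ, Fintype.card_fin, nsmul_eq_mul] at h1
      rw [mul_inv_cancel₀ hmR, ← div_eq_mul_inv, div_le_one hq0] at h1
      exact h1
    have hA := isSumSq_sum_pow_sub_mul_prod hm fun j => s j • y j
    have key : ∑ j, w j • y j ^ m - c • ∏ j, y j =
        (1 - c / q) • ∑ j, w j • y j ^ m +
          (c / q * (m : ℝ)⁻¹) • (∑ j, (s j • y j) ^ m - (m : ℝ) • ∏ j, s j • y j) := by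
      have h1 : ∑ j, (s j • y j) ^ m = (m : ℝ) • ∑ j, w j • y j ^ m := by
        simp_rw [smul_pow, hsm, Finset.smul_sum, smul_smul]
      rw [h1, Finset.prod_smul, ← hq]
      have hq0' := hq0.ne'
      match_scalars <;> field_simp
      ring
    rw [key]
    exact (IsSumSq.smul_nonneg (sub_nonneg.mpr ((div_le_one hq0).mpr hcq)) hsum).add
      (IsSumSq.smul_nonneg (by positivity) hA)
  · push Not at hpos
    obtain ⟨j₀, hj₀⟩ := hpos
    have hw0 : w j₀ = 0 := le_antisymm hj₀ (hw j₀)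
    have hc0 : c = 0 := by
      by_contra hne
      have hcpos : 0 < c := lt_of_le_of_ne hc (Ne.symm hne)
      set W := ∑ j, w j
      have hW : 0 ≤ W := Finset.sum_nonneg fun j _ => hw j
      have h1 := h (Function.update 1 j₀ ((W + 1) / c)) (by
        intro j
        by_cases hj : j = j₀
        · subst hj; simp; positivity
        · simp [hj])
      rw [Finset.prod_update_of_mem (Finset.mem_univ _)] at h1
      have h2 : ∀ j, w j * Function.update (1 : Fin m → ℝ) j₀ ((W + 1) / c) j ^ m = w j := by
        intro j
        by_cases hj : j = j₀
        · subst hj; simp [hw0]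
        · simp [hj]
      rw [Finset.sum_congr rfl fun j _ => h2 j] at h1
      simp only [Pi.one_apply, Finset.prod_const_one, mul_one] at h1
      rw [mul_div_cancel₀ _ hne] at h1
      linarith
    simpa [hc0] using hsum

end SumOfSquares

section Alternative

variable {L I K : Type*} [Fintype L] {m : ℕ}

/-- Pairs of convex multipliers `λ` and weights `w` such that each form
`∑ⱼ w i j xⱼᵐ - (∑ₗ λ l c l i) ∏ⱼ xⱼ` is nonnegative on the nonnegative orthant. -/
def amgmWeights (m : ℕ) (c : L → I → ℝ) : Set ((L → ℝ) × (I → Fin m → ℝ)) :=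
  {q | (∀ l, 0 ≤ q.1 l) ∧ ∑ l, q.1 l = 1 ∧ (∀ i j, 0 ≤ q.2 i j) ∧
    ∀ i (x : Fin m → ℝ), (∀ j, 0 ≤ x j) →
      (∑ l, q.1 l * c l i) * ∏ j, x j ≤ ∑ j, q.2 i j * x j ^ m}

theorem convex_amgmWeights (c : L → I → ℝ) : Convex ℝ (amgmWeights m c) := by
  rintro ⟨l₁, w₁⟩ ⟨h1, h2, h3, h4⟩ ⟨l₂, w₂⟩ ⟨k1, k2, k3, k4⟩ s t hs ht hst
  refine ⟨fun l => ?_, ?_, fun i j => ?_, fun i x hx => ?_⟩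
  · have := h1 l; have := k1 l
    simp only [Prod.smul_mk, Prod.mk_add_mk, Pi.add_apply, Pi.smul_apply, smul_eq_mul] at *
    positivity
  · simp only [Prod.smul_mk, Prod.mk_add_mk, Pi.add_apply, Pi.smul_apply, smul_eq_mul,
      Finset.sum_add_distrib, ← Finset.mul_sum] at *
    rw [h2, k2]; linarith
  · have := h3 i j; have := k3 i j
    simp only [Prod.smul_mk, Prod.mk_add_mk, Pi.add_apply, Pi.smul_apply, smul_eq_mul] at *
    positivity
  · have a1 := mul_le_mul_of_nonneg_left (h4 i x hx) hs
    have a2 := mul_le_mul_of_nonneg_left (k4 i x hx) ht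
    simp only [Prod.smul_mk, Prod.mk_add_mk, Pi.add_apply, Pi.smul_apply, smul_eq_mul,
      Finset.sum_add_distrib, add_mul, mul_assoc, ← Finset.mul_sum] at *
    linarith

theorem isClosed_amgmWeights (c : L → I → ℝ) : IsClosed (amgmWeights m c) := by
  simp only [amgmWeights, Set.ofPred_and, Set.ofPred_forall]
  refine IsClosed.inter ?_ (IsClosed.inter ?_ (IsClosed.inter ?_ ?_))
  · exact isClosed_iInter fun l => isClosed_le (by fun_prop) (by fun_prop)
  · exact isClosed_eq (by fun_prop) (by fun_prop)
  · exact isClosed_iInter fun i => isClosed_iInter fun j =>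
      isClosed_le (by fun_prop) (by fun_prop)
  · exact isClosed_iInter fun i => isClosed_iInter fun x => isClosed_iInter fun _ =>
      isClosed_le (by fun_prop) (by fun_prop)

theorem le_one_of_mem_amgmWeights {c : L → I → ℝ} {q : (L → ℝ) × (I → Fin m → ℝ)}
    (hq : q ∈ amgmWeights m c) (l : L) : q.1 l ≤ 1 := by
  rw [← hq.2.1]
  exact Finset.single_le_sum (fun l _ => hq.1 l) (Finset.mem_univ l)

theorem sum_mul_le_sum_abs {c : L → I → ℝ} {q : (L → ℝ) × (I → Fin m → ℝ)}
    (hq : q ∈ amgmWeights m c) (a : L → ℝ) : ∑ l, q.1 l * a l ≤ ∑ l, |a l| := by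
  refine Finset.sum_le_sum fun l _ => ?_
  calc q.1 l * a l ≤ q.1 l * |a l| := mul_le_mul_of_nonneg_left (le_abs_self _) (hq.1 l)
    _ ≤ 1 * |a l| := mul_le_mul_of_nonneg_right (le_one_of_mem_amgmWeights hq l) (abs_nonneg _)
    _ = |a l| := one_mul _

variable [Fintype I] [DecidableEq K]

/-- The part of the diagonal coefficients left over once the weights are subtracted. -/
def diagSlack (b : L → K → ℝ) (e : I → Fin m → K) (q : (L → ℝ) × (I → Fin m → ℝ)) (k : K) : ℝ :=
  ∑ l, q.1 l * b l k - ∑ i, ∑ j, if e i j = k then q.2 i j else 0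

theorem diagSlack_combo (b : L → K → ℝ) (e : I → Fin m → K) (q r : (L → ℝ) × (I → Fin m → ℝ))
    (s t : ℝ) (k : K) :
    diagSlack b e (s • q + t • r) k = s * diagSlack b e q k + t * diagSlack b e r k := by
  have h : ∀ i j, (if e i j = k then s * q.2 i j + t * r.2 i j else 0) =
      s * (if e i j = k then q.2 i j else 0) + t * (if e i j = k then r.2 i j else 0) := by
    intro i j; split_ifs <;> simp
  simp only [diagSlack, Prod.fst_add, Prod.snd_add, Prod.smul_fst, Prod.smul_snd, Pi.add_apply,
    Pi.smul_apply, smul_eq_mul, h, Finset.sum_add_distrib, add_mul, mul_assoc, ← Finset.mul_sum]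
  ring

theorem continuous_diagSlack (b : L → K → ℝ) (e : I → Fin m → K) (k : K) :
    Continuous fun q => diagSlack b e q k := by
  unfold diagSlack
  refine Continuous.sub (by fun_prop) (continuous_finsetSum _ fun i _ =>
    continuous_finsetSum _ fun j _ => ?_)
  split_ifs <;> fun_prop

theorem diagSlack_le {c : L → I → ℝ} {q : (L → ℝ) × (I → Fin m → ℝ)}
    (hq : q ∈ amgmWeights m c) (b : L → K → ℝ) (e : I → Fin m → K) (k : K) :
    diagSlack b e q k ≤ ∑ l, |b l k| := by
  have h := sum_mul_le_sum_abs hq fun l => b l k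
  have h2 : 0 ≤ ∑ i, ∑ j, if e i j = k then q.2 i j else 0 :=
    Finset.sum_nonneg fun i _ => Finset.sum_nonneg fun j _ => by
      split_ifs
      exacts [hq.2.2.1 i j, le_rfl]
  unfold diagSlack
  linarith

theorem weight_le_of_le_diagSlack {c : L → I → ℝ} {q : (L → ℝ) × (I → Fin m → ℝ)}
    (hq : q ∈ amgmWeights m c) (b : L → K → ℝ) (e : I → Fin m → K) (i : I) (j : Fin m)
    {r : ℝ} (hr : r ≤ diagSlack b e q (e i j)) :
    q.2 i j ≤ ∑ l, |b l (e i j)| - r := by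
  have h := sum_mul_le_sum_abs hq fun l => b l (e i j)
  have hnn : ∀ i' j', 0 ≤ if e i' j' = e i j then q.2 i' j' else 0 := by
    intro i' j'
    split_ifs
    exacts [hq.2.2.1 i' j', le_rfl]
  have h2 : q.2 i j ≤ ∑ i', ∑ j', if e i' j' = e i j then q.2 i' j' else 0 := by
    calc q.2 i j = if e i j = e i j then q.2 i j else 0 := by simp
      _ ≤ ∑ j', if e i j' = e i j then q.2 i j' else 0 :=
        Finset.single_le_sum (f := fun j' => if e i j' = e i j then q.2 i j' else 0)
          (fun j' _ => hnn i j') (Finset.mem_univ j)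
      _ ≤ _ := Finset.single_le_sum
          (f := fun i' => ∑ j', if e i' j' = e i j then q.2 i' j' else 0)
          (fun i' _ => Finset.sum_nonneg fun j' _ => hnn i' j') (Finset.mem_univ i)
  unfold diagSlack at hr
  linarith

/-- Limits of vectors dominated by attainable slacks are again dominated. -/
theorem isClosed_setOf_le_diagSlack [Fintype K] (b : L → K → ℝ) (c : L → I → ℝ)
    (e : I → Fin m → K) :
    IsClosed {v : K → ℝ | ∃ q ∈ amgmWeights m c, ∀ k, v k ≤ diagSlack b e q k} := by
  refine IsSeqClosed.isClosed fun v a hv ha => ?_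
  choose q hq hqv using hv
  obtain ⟨M, hM⟩ : ∃ M, ∀ n k, M ≤ v n k := by
    obtain ⟨R, hR⟩ := (Metric.isBounded_range_of_tendsto v ha).exists_norm_le
    exact ⟨-R, fun n k => neg_le_of_abs_le
      ((norm_le_pi_norm (v n) k).trans (hR _ (Set.mem_range_self n)))⟩
  have hK : IsCompact (amgmWeights m c ∩
      Set.Icc 0 ((fun _ => 1, fun i j => ∑ l, |b l (e i j)| - M) :
        (L → ℝ) × (I → Fin m → ℝ))) := isCompact_Icc.inter_left (isClosed_amgmWeights c)
  obtain ⟨q₀, hq₀, φ, hφ, hlim⟩ := hK.tendsto_subseq (x := q) fun n =>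
    ⟨hq n, ⟨fun l => (hq n).1 l, fun i j => (hq n).2.2.1 i j⟩,
      ⟨fun l => le_one_of_mem_amgmWeights (hq n) l, fun i j =>
        weight_le_of_le_diagSlack (hq n) b e i j ((hM n _).trans (hqv n _))⟩⟩
  refine ⟨q₀, hq₀.1, fun k => ?_⟩
  exact le_of_tendsto_of_tendsto'
    (((tendsto_pi_nhds.mp ha) k).comp hφ.tendsto_atTop)
    (((continuous_diagSlack b e k).tendsto q₀).comp hlim) fun n => hqv (φ n) k

/-- For positive `y`, the weights making the arithmetic-geometric mean inequality tight at `y`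
are admissible. -/
theorem exists_tight_weights [Fintype K] [DecidableEq L] (hm0 : 0 < m) (b : L → K → ℝ)
    {c : L → I → ℝ} (hc : ∀ l i, 0 ≤ c l i) (e : I → Fin m → K) {y : K → ℝ} (hy : ∀ k, 0 < y k)
    (l : L) :
    ∃ q ∈ amgmWeights m c, ∑ k, y k ^ m * diagSlack b e q k =
      ∑ k, b l k * y k ^ m - ∑ i, c l i * ∏ j, y (e i j) := by
  have hmR : (m : ℝ) ≠ 0 := by positivity
  have hP : ∀ i, 0 < ∏ j, y (e i j) := fun i => Finset.prod_pos fun j _ => hy _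
  refine ⟨(Pi.single l 1, fun i j => c l i * (m : ℝ)⁻¹ * (∏ j, y (e i j)) / y (e i j) ^ m),
    ⟨fun l' => ?_, ?_, fun i j => ?_, fun i x hx => ?_⟩, ?_⟩
  · by_cases h : l' = l
    · subst h; simp
    · simp [h]
  · simp
  · have := hc l i; have := hP i; have := hy (e i j)
    positivity
  · have hsum : ∑ l', (Pi.single l 1 : L → ℝ) l' * c l' i = c l i := by
      simp [Pi.single_apply]
    have h1 : ∏ j, (x j / y (e i j)) ≤ ∑ j, (m : ℝ)⁻¹ * (x j / y (e i j)) ^ m := by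
      have := Real.geom_mean_le_arith_mean_weighted Finset.univ (fun _ : Fin m => (m : ℝ)⁻¹)
        (fun j => (x j / y (e i j)) ^ m) (fun _ _ => by positivity)
        (by simp [hmR]) (fun j _ => pow_nonneg (div_nonneg (hx j) (hy _).le) _)
      refine le_trans (le_of_eq (Finset.prod_congr rfl fun j _ => ?_)) this
      exact (Real.pow_rpow_inv_natCast (div_nonneg (hx j) (hy _).le) hm0.ne').symm
    have h2 := mul_le_mul_of_nonneg_left h1 (mul_nonneg (hc l i) (hP i).le)
    rw [Finset.prod_div_distrib, mul_assoc, mul_div_cancel₀ _ (hP i).ne', Finset.mul_sum] at h2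
    simp only [hsum]
    refine h2.trans (le_of_eq (Finset.sum_congr rfl fun j _ => ?_))
    rw [div_pow]
    ring
  · have hb : ∀ k, ∑ l', (Pi.single l 1 : L → ℝ) l' * b l' k = b l k := by
      intro k; simp [Pi.single_apply]
    simp only [diagSlack, hb, mul_sub, Finset.sum_sub_distrib, Finset.mul_sum]
    congr 1
    · exact Finset.sum_congr rfl fun k _ => mul_comm _ _
    · rw [Finset.sum_comm]
      refine Finset.sum_congr rfl fun i _ => ?_
      rw [Finset.sum_comm]
      simp only [mul_ite, mul_zero, Finset.sum_ite_eq, Finset.mem_univ, if_true]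
      have : ∀ j, y (e i j) ^ m * (c l i * (m : ℝ)⁻¹ * (∏ j, y (e i j)) / y (e i j) ^ m) =
          (m : ℝ)⁻¹ * (c l i * ∏ j, y (e i j)) := by
        intro j
        have := (pow_pos (hy (e i j)) m).ne'
        field_simp
      rw [Finset.sum_congr rfl fun j _ => this j]
      simp [hmR]

/-- Either some convex combination of the forms `∑ₖ b l k yₖᵐ - ∑ᵢ c l i ∏ⱼ y (e i j)` splits
into arithmetic-geometric mean forms, or all the forms are negative at a common positive point. -/
theorem exists_diagSlack_nonneg_or_exists_neg [Fintype K] [Nonempty L] (hm0 : 0 < m)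
    (b : L → K → ℝ) {c : L → I → ℝ} (hc : ∀ l i, 0 ≤ c l i) (e : I → Fin m → K) :
    (∃ q ∈ amgmWeights m c, ∀ k, 0 ≤ diagSlack b e q k) ∨
      ∃ y : K → ℝ, ∀ l, ∑ k, b l k * y k ^ m - ∑ i, c l i * ∏ j, y (e i j) < 0 := by
  classical
  set S := {v : K → ℝ | ∃ q ∈ amgmWeights m c, ∀ k, v k ≤ diagSlack b e q k} with hS
  by_cases h0 : (0 : K → ℝ) ∈ S
  · exact Or.inl h0
  right
  have hconv : Convex ℝ S := by
    rintro v ⟨q, hq, hqv⟩ v' ⟨q', hq', hqv'⟩ s t hs ht hst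
    refine ⟨s • q + t • q', convex_amgmWeights c hq hq' hs ht hst, fun k => ?_⟩
    rw [diagSlack_combo]
    exact add_le_add (mul_le_mul_of_nonneg_left (hqv k) hs)
      (mul_le_mul_of_nonneg_left (hqv' k) ht)
  obtain ⟨f, u, hf, hu⟩ :=
    geometric_hahn_banach_closed_point hconv (isClosed_setOf_le_diagSlack b c e) h0
  rw [map_zero] at hu
  set z : K → ℝ := fun k => f (Pi.single k 1) with hz
  have hfz : ∀ v, f v = ∑ k, z k * v k := by
    intro v
    conv_lhs => rw [pi_eq_sum_univ' v]
    simp [hz, map_sum, mul_comm]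
  have hz0 : ∀ k, 0 ≤ z k := by
    intro k
    by_contra! hneg
    obtain ⟨q, hq, -⟩ := exists_tight_weights hm0 b hc e (y := fun _ => 1)
      (fun _ => one_pos) (Classical.arbitrary L)
    have ht : 0 ≤ |f (diagSlack b e q)| / -z k := div_nonneg (abs_nonneg _) (by linarith)
    have h1 := hf (diagSlack b e q - (|f (diagSlack b e q)| / -z k) • Pi.single k 1)
      ⟨q, hq, fun k' => by
        have : (0 : ℝ) ≤ (Pi.single k 1 : K → ℝ) k' := by
          rw [Pi.single_apply]
          split_ifs <;> norm_num
        simp only [Pi.sub_apply, Pi.smul_apply, smul_eq_mul]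
        nlinarith [mul_nonneg ht this]⟩
    have h2 : |f (diagSlack b e q)| / -z k * z k = -|f (diagSlack b e q)| := by
      rw [div_neg, neg_mul, div_mul_cancel₀ _ hneg.ne]
    rw [map_sub, map_smul, smul_eq_mul, h2] at h1
    linarith [neg_abs_le (f (diagSlack b e q))]
  set B : ℝ := ∑ k, ∑ l, |b l k| with hB
  have hB0 : 0 ≤ B := Finset.sum_nonneg fun _ _ => Finset.sum_nonneg fun _ _ => abs_nonneg _
  set δ : ℝ := -u / (1 + B) with hδ
  have hδ0 : 0 < δ := div_pos (neg_pos.mpr hu) (by linarith)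
  have hδB : δ * B ≤ -u := by
    have : δ * (1 + B) = -u := div_mul_cancel₀ _ (by linarith)
    nlinarith
  have hpos : ∀ k, 0 < z k + δ := fun k => add_pos_of_nonneg_of_pos (hz0 k) hδ0
  refine ⟨fun k => (z k + δ) ^ ((m : ℝ)⁻¹), fun l => ?_⟩
  obtain ⟨q, hq, hqe⟩ := exists_tight_weights hm0 b hc e
    (y := fun k => (z k + δ) ^ ((m : ℝ)⁻¹)) (fun k => Real.rpow_pos_of_pos (hpos k) _) l
  rw [← hqe]
  have h1 := hf _ ⟨q, hq, fun k => le_rfl⟩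
  rw [hfz] at h1
  have h2 : ∑ k, diagSlack b e q k ≤ B := Finset.sum_le_sum fun k _ => diagSlack_le hq b e k
  have h3 := mul_le_mul_of_nonneg_left h2 hδ0.le
  simp only [Real.rpow_inv_natCast_pow (hpos _).le hm0.ne', add_mul, Finset.sum_add_distrib,
    ← Finset.mul_sum]
  linarith

end Alternative

section Tensors

variable {m n : ℕ}

open scoped Classical in
theorem sum_smul_prod_eq_diag_sub {R : Type*} [CommRing R] [Algebra ℝ R] (hm0 : 0 < m)
    (A : (Fin m → Fin n) → ℝ) (y : Fin n → R) :
    ∑ i, A i • ∏ j, y (i j) = ∑ k, A (fun _ => k) • y k ^ m -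
      ∑ i, (if ∀ j j', i j = i j' then 0 else -A i) • ∏ j, y (i j) := by
  have h : ∑ k, A (fun _ => k) • y k ^ m =
      ∑ i with ∀ j j' : Fin m, i j = i j', A i • ∏ j, y (i j) := by
    refine Finset.sum_bij' (fun k _ _ => k) (fun i _ => i ⟨0, hm0⟩) ?_ ?_ ?_ ?_ ?_
    · simp
    · simp
    · simp
    · intro i hi
      funext j
      exact (Finset.mem_filter.mp hi).2 _ _
    · simp
  rw [h, Finset.sum_filter, ← Finset.sum_sub_distrib]
  refine Finset.sum_congr rfl fun i _ => ?_
  split_ifs <;> simp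

/-- The homogeneous polynomial `⟨A, x^{⊗m}⟩`. -/
def tensorPoly (A : (Fin m → Fin n) → ℝ) : MvPolynomial (Fin n) ℝ :=
  ∑ i, A i • ∏ j, X (i j)

theorem eval_tensorPoly (A : (Fin m → Fin n) → ℝ) (x : Fin n → ℝ) :
    eval x (tensorPoly A) = tIP A (rk1 m x) := by
  simp [tensorPoly, tIP, rk1, smul_eval, map_sum, map_prod]

theorem tIP_sum_smul {ι : Type*} [Fintype ι] (lam : ι → ℝ) (F : ι → (Fin m → Fin n) → ℝ)
    (B : (Fin m → Fin n) → ℝ) :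
    tIP (∑ l, lam l • F l) B = ∑ l, lam l * tIP (F l) B := by
  simp only [tIP, Finset.sum_apply, Pi.smul_apply, smul_eq_mul, Finset.sum_mul, Finset.mul_sum,
    mul_assoc]
  exact Finset.sum_comm

theorem tIP_pmul_rk1 (P : Matrix (Fin n) (Fin n) ℝ) (A : (Fin m → Fin n) → ℝ) (y : Fin n → ℝ) :
    tIP (pmul P A) (rk1 m y) = tIP A (rk1 m (Matrix.vecMul y P)) := by
  have h : ∀ j : Fin m → Fin n, rk1 m (Matrix.vecMul y P) j =
      ∑ i : Fin m → Fin n, ∏ k, y (i k) * P (i k) (j k) := by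
    intro j
    simp only [rk1, Matrix.vecMul, dotProduct]
    rw [Finset.prod_univ_sum, Fintype.piFinset_univ]
  simp only [tIP, h]
  simp only [pmul, rk1, Finset.sum_mul, Finset.mul_sum, Finset.prod_mul_distrib]
  rw [Finset.sum_comm]
  exact Finset.sum_congr rfl fun j _ => Finset.sum_congr rfl fun i _ => by ring

/-- A theorem of the alternative for essentially nonpositive tensors. -/
theorem exists_neg_or_exists_isSumSq_tensorPoly {ι : Type*} [Fintype ι] [Nonempty ι]
    (hm : Even m) (hm0 : 0 < m) (G : ι → (Fin m → Fin n) → ℝ) (hG : ∀ l, EssNonpos (G l)) :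
    (∃ y : Fin n → ℝ, ∀ l, tIP (G l) (rk1 m y) < 0) ∨
      ∃ lam : ι → ℝ, (∀ l, 0 ≤ lam l) ∧ ∑ l, lam l = 1 ∧
        IsSumSq (∑ l, lam l • tensorPoly (G l)) := by
  classical
  set c : ι → (Fin m → Fin n) → ℝ := fun l i =>
    if ∀ j j', i j = i j' then 0 else -G l i with hc
  set b : ι → Fin n → ℝ := fun l k => G l fun _ => k with hb
  have hc0 : ∀ l i, 0 ≤ c l i := by
    intro l i
    simp only [hc]
    split_ifs with h
    exacts [le_rfl, neg_nonneg.mpr (hG l i h)]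
  rcases exists_diagSlack_nonneg_or_exists_neg hm0 b hc0 (fun i => i) with
    ⟨⟨lam, w⟩, ⟨hl0, hl1, hw, hcw⟩, hs⟩ | ⟨y, hy⟩
  · refine Or.inr ⟨lam, hl0, hl1, ?_⟩
    have key : ∑ l, lam l • tensorPoly (G l) =
        ∑ k, diagSlack b (fun i => i) (lam, w) k • (X k : MvPolynomial (Fin n) ℝ) ^ m +
          ∑ i, (∑ j, w i j • (X (i j) : MvPolynomial (Fin n) ℝ) ^ m -
            (∑ l, lam l * c l i) • ∏ j, X (i j)) := by
      have h1 : ∀ l, tensorPoly (G l) = ∑ k, b l k • X k ^ m - ∑ i, c l i • ∏ j, X (i j) :=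
        fun l => sum_smul_prod_eq_diag_sub hm0 (G l) X
      have h2 : ∑ k, (∑ i : Fin m → Fin n, ∑ j, if i j = k then w i j else 0) •
          (X k : MvPolynomial (Fin n) ℝ) ^ m = ∑ i, ∑ j, w i j • X (i j) ^ m := by
        simp only [Finset.sum_smul]
        rw [Finset.sum_comm]
        refine Finset.sum_congr rfl fun i _ => ?_
        rw [Finset.sum_comm]
        simp [ite_smul]
      simp only [h1, diagSlack, sub_smul, Finset.sum_sub_distrib, h2]
      simp only [smul_sub, Finset.smul_sum, Finset.sum_sub_distrib, smul_smul, Finset.sum_smul]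
      rw [Finset.sum_comm (f := fun l k => (lam l * b l k) • (X k : MvPolynomial (Fin n) ℝ) ^ m),
        Finset.sum_comm (f := fun l i =>
          (lam l * c l i) • ∏ j, (X (i j) : MvPolynomial (Fin n) ℝ))]
      abel
    rw [key]
    refine IsSumSq.add (IsSumSq.sum fun k _ => IsSumSq.smul_nonneg (hs k)
      (isSumSq_pow_of_even hm _)) (IsSumSq.sum fun i _ => ?_)
    exact isSumSq_sum_smul_pow_sub_smul_prod hm hm0 (hw i)
      (Finset.sum_nonneg fun l _ => mul_nonneg (hl0 l) (hc0 l i)) (hcw i) fun j => X (i j)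
  · refine Or.inl ⟨y, fun l => ?_⟩
    have := sum_smul_prod_eq_diag_sub hm0 (G l) y
    simp only [smul_eq_mul] at this
    simp only [tIP, rk1]
    rw [this]
    exact hy l

theorem IsSumSq.exists_fin_sum_sq {R : Type*} [CommSemiring R] {f : R} (hf : IsSumSq f) :
    ∃ (r : ℕ) (g : Fin r → R), f = ∑ j, g j ^ 2 := by
  induction hf with
  | zero => exact ⟨0, Fin.elim0, by simp⟩
  | sq_add a _ ih =>
    obtain ⟨r, g, rfl⟩ := ih
    exact ⟨r + 1, Fin.cons a g, by simp [Fin.sum_univ_succ, sq]⟩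

theorem IsSOSFun.of_isSumSq_comp_vecMul {f : MvPolynomial (Fin n) ℝ} (hf : IsSumSq f)
    (Q : Matrix (Fin n) (Fin n) ℝ) : IsSOSFun fun x => eval (Matrix.vecMul x Q) f := by
  obtain ⟨r, g, rfl⟩ := hf.exists_fin_sum_sq
  refine ⟨r, fun j => bind₁ (fun k => ∑ i, X i * C (Q i k)) (g j), fun x => ?_⟩
  have h : ∀ j, eval x (bind₁ (fun k => ∑ i, X i * C (Q i k)) (g j)) =
      eval (Matrix.vecMul x Q) (g j) := by
    intro j
    rw [eval, eval₂Hom_bind₁]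
    congr 2
    funext k
    simp [Matrix.vecMul, dotProduct]
  simp [h]

end Tensors

/-- Tensor analogy of Yuan's theorem of the alternative. -/
theorem stmt9 (m n p : ℕ) (hm : Even m) (hm0 : 0 < m)
    (F : Fin (p + 1) → (Fin m → Fin n) → ℝ) (hFs : ∀ l, TSymm (F l))
    (P : Matrix (Fin n) (Fin n) ℝ) (hP : IsUnit P.det)
    (hEN : ∀ l, EssNonpos (pmul P (F l))) :
    Xor' (∃ x : Fin n → ℝ, ∀ l, tIP (F l) (rk1 m x) < 0)
      (∃ lam : Fin (p + 1) → ℝ, (∀ l, 0 ≤ lam l) ∧ (∑ l, lam l) = 1 ∧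
        IsSOSFun (fun x : Fin n → ℝ => tIP (∑ l, lam l • F l) (rk1 m x))) := by
  change Xor _ _
  rw [xor_iff_or_and_not_and]
  constructor
  · rcases exists_neg_or_exists_isSumSq_tensorPoly hm hm0 (fun l => pmul P (F l)) hEN with
      ⟨y, hy⟩ | ⟨lam, h0, h1, hsq⟩
    · exact Or.inl ⟨Matrix.vecMul y P, fun l => tIP_pmul_rk1 P (F l) y ▸ hy l⟩
    · refine Or.inr ⟨lam, h0, h1, ?_⟩
      convert IsSOSFun.of_isSumSq_comp_vecMul hsq P⁻¹ using 2 with x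
      simp only [map_sum, smul_eval, eval_tensorPoly, tIP_sum_smul, tIP_pmul_rk1,
        Matrix.vecMul_vecMul, Matrix.nonsing_inv_mul P hP, Matrix.vecMul_one]
  · rintro ⟨⟨x, hx⟩, lam, h0, h1, r, g, hg⟩
    have hnn : 0 ≤ ∑ l, lam l * tIP (F l) (rk1 m x) := by
      rw [← tIP_sum_smul]
      refine le_of_le_of_eq ?_ (hg x).symm
      exact Finset.sum_nonneg fun j _ => sq_nonneg _
    obtain ⟨l, -, hl⟩ := Finset.exists_ne_zero_of_sum_ne_zero (h1.trans_ne one_ne_zero)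
    refine hnn.not_gt (Finset.sum_neg' (fun l _ => mul_nonpos_of_nonneg_of_nonpos (h0 l)
      (hx l).le) ⟨l, Finset.mem_univ l, mul_neg_of_pos_of_neg ((h0 l).lt_of_ne' hl) (hx l)⟩)
end
end
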